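/- The map d ↦ ‖d^{-1/2}·(z₁ + ⋯ + z_d)‖_{L^p(T^d)} is strictly increasing in the positive integer d, for fixed real p with 2 < p < ∞; i.e., for every d ≥ 1, ∫_{T^d} |z₁+⋯+z_d|^p / d^{p/2} dm_d < ∫_{T^{d+1}} |z₁+⋯+z_{d+1}|^p / (d+1)^{p/2} dm_{d+1}. -/

import Mathlib

open MeasureTheory

/-- The `p`-th moment of the normalized sum `d^{-1/2}(z₁ + ⋯ + z_d)` on the `d`-torus,
parametrized by `θ ∈ (0,1]^d` via `z_j = e^{2πiθ_j}`. -/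
noncomputable def normSumMoment (p : ℝ) (d : ℕ) : ℝ :=
  (∫ θ in Set.univ.pi fun _ : Fin d => Set.Ioc (0:ℝ) 1,
    ‖∑ j, Complex.exp (2 * Real.pi * Complex.I * θ j)‖ ^ p) / (d : ℝ) ^ (p / 2)

open Set Real

theorem hasDerivAt_intervalIntegral_of_continuousOn {F F' : ℝ → ℝ → ℝ} {U : Set ℝ} {x₀ a b : ℝ}
    (hU : IsOpen U) (hx₀ : x₀ ∈ U)
    (hF : ContinuousOn (fun x : ℝ × ℝ => F x.1 x.2) (U ×ˢ univ))
    (hF' : ContinuousOn (fun x : ℝ × ℝ => F' x.1 x.2) (U ×ˢ univ))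
    (hd : ∀ x ∈ U, ∀ θ, HasDerivAt (fun y => F y θ) (F' x θ) x) :
    HasDerivAt (fun x => ∫ θ in a..b, F x θ) (∫ θ in a..b, F' x₀ θ) x₀ := by
  have hcont : ∀ G : ℝ → ℝ → ℝ, ContinuousOn (fun x : ℝ × ℝ => G x.1 x.2) (U ×ˢ univ) →
      ∀ x ∈ U, Continuous (G x) := fun G hG x hx =>
    hG.comp_continuous (f := fun θ : ℝ => (x, θ)) (by fun_prop) fun θ => ⟨hx, mem_univ _⟩
  obtain ⟨ε, hε, hball⟩ := Metric.nhds_basis_closedBall.mem_iff.1 (hU.mem_nhds hx₀)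
  obtain ⟨C, hC⟩ := ((isCompact_closedBall x₀ ε).prod
    (isCompact_uIcc (a := a) (b := b))).exists_bound_of_continuousOn
    (hF'.mono (prod_mono hball (subset_univ _)))
  refine (intervalIntegral.hasDerivAt_integral_of_dominated_loc_of_deriv_le
    (bound := fun _ => C) (Metric.closedBall_mem_nhds x₀ hε) ?_
    ((hcont F hF x₀ hx₀).intervalIntegrable _ _) (hcont F' hF' x₀ hx₀).aestronglyMeasurable
    ?_ (by simp) ?_).2
  · filter_upwards [hU.mem_nhds hx₀] with x hx using (hcont F hF x hx).aestronglyMeasurable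
  · exact ae_of_all _ fun θ hθ x hx => hC (x, θ) ⟨hx, uIoc_subset_uIcc hθ⟩
  · exact ae_of_all _ fun θ _ x hx => hd x (hball hx) θ

/-- The squared modulus of `a + √t e^{iθ}`. -/
noncomputable def sqMod (a t θ : ℝ) : ℝ := a ^ 2 + t + 2 * a * √t * cos θ

section sqMod

variable {a t q : ℝ}

theorem sqMod_eq (ht : 0 ≤ t) (θ : ℝ) :
    sqMod a t θ = (√t + a * cos θ) ^ 2 + (a * sin θ) ^ 2 := by
  unfold sqMod
  linear_combination (-1) * sq_sqrt ht - a ^ 2 * sin_sq_add_cos_sq θ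

theorem sqMod_nonneg (ht : 0 ≤ t) (θ : ℝ) : 0 ≤ sqMod a t θ := by
  rw [sqMod_eq ht]; positivity

theorem sqMod_pos (ht : 0 ≤ t) (hne : t ≠ a ^ 2) (θ : ℝ) : 0 < sqMod a t θ := by
  refine (sqMod_nonneg ht θ).lt_of_ne' fun h => hne ?_
  rw [sqMod_eq ht] at h
  have h1 : √t + a * cos θ = 0 := by nlinarith [sq_nonneg (√t + a * cos θ), sq_nonneg (a * sin θ)]
  have h2 : a * sin θ = 0 := by nlinarith [sq_nonneg (√t + a * cos θ), sq_nonneg (a * sin θ)]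
  rw [← sq_sqrt ht]
  linear_combination (√t - a * cos θ) * h1 - a * sin θ * h2 + a ^ 2 * sin_sq_add_cos_sq θ

theorem continuous_sqMod : Continuous fun x : ℝ × ℝ => sqMod a x.1 x.2 := by
  unfold sqMod; fun_prop

theorem hasDerivAt_sqMod (ht : 0 < t) (θ : ℝ) :
    HasDerivAt (fun s => sqMod a s θ) (1 + a * cos θ / √t) t := by
  unfold sqMod
  refine (((hasDerivAt_id t).const_add (a ^ 2)).add
    (((hasDerivAt_sqrt ht.ne').const_mul (2 * a)).mul_const (cos θ))).congr_deriv ?_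
  field_simp

theorem continuousOn_sqMod_rpow (r : ℝ) :
    ContinuousOn (fun x : ℝ × ℝ => sqMod a x.1 x.2 ^ r) ((Ioi 0 \ {a ^ 2}) ×ˢ univ) :=
  continuous_sqMod.continuousOn.rpow_const fun x hx =>
    Or.inl (sqMod_pos (le_of_lt hx.1.1) hx.1.2 x.2).ne'

theorem isOpen_Ioi_diff_singleton {x y : ℝ} : IsOpen (Ioi x \ {y}) :=
  isOpen_Ioi.sdiff isClosed_singleton

theorem continuousOn_div_sqrt :
    ContinuousOn (fun x : ℝ × ℝ => a * cos x.2 / √x.1) (Ioi 0 ×ˢ univ) :=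
  ContinuousOn.div (by fun_prop) (by fun_prop) fun x hx => (sqrt_pos.2 hx.1).ne'

/-- The derivative of the `q`-th power mean. -/
theorem hasDerivAt_integral_sqMod_rpow (hq : 1 < q) (ht : 0 < t) :
    HasDerivAt (fun s => ∫ θ in (0)..(2 * π), sqMod a s θ ^ q)
      (∫ θ in (0)..(2 * π), q * sqMod a t θ ^ (q - 1) * (1 + a * cos θ / √t)) t := by
  refine hasDerivAt_intervalIntegral_of_continuousOn (F := fun s θ => sqMod a s θ ^ q)
    (F' := fun s θ => q * sqMod a s θ ^ (q - 1) * (1 + a * cos θ / √s)) isOpen_Ioi ht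
    (continuous_sqMod.rpow_const fun _ => Or.inr (by linarith)).continuousOn ?_ ?_
  · exact (continuousOn_const.mul (continuous_sqMod.rpow_const
      fun _ => Or.inr (by linarith)).continuousOn).mul (continuousOn_const.add continuousOn_div_sqrt)
  · intro s hs θ
    convert (hasDerivAt_sqMod (a := a) hs θ).rpow_const (p := q) (Or.inr hq.le) using 1
    ring

theorem hasDerivAt_integral_sqMod_rpow_of_ne (ht : 0 < t) (hne : t ≠ a ^ 2) :
    HasDerivAt (fun s => ∫ θ in (0)..(2 * π), sqMod a s θ ^ q)
      (∫ θ in (0)..(2 * π), q * sqMod a t θ ^ (q - 1) * (1 + a * cos θ / √t)) t := by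
  refine hasDerivAt_intervalIntegral_of_continuousOn (F := fun s θ => sqMod a s θ ^ q)
    (F' := fun s θ => q * sqMod a s θ ^ (q - 1) * (1 + a * cos θ / √s))
    isOpen_Ioi_diff_singleton ⟨ht, hne⟩ (continuousOn_sqMod_rpow q) ?_ ?_
  · exact (continuousOn_const.mul (continuousOn_sqMod_rpow _)).mul
      (continuousOn_const.add (continuousOn_div_sqrt.mono (prod_mono sdiff_subset Subset.rfl)))
  · intro s hs θ
    convert (hasDerivAt_sqMod (a := a) hs.1 θ).rpow_const (p := q)
      (Or.inl (sqMod_pos (le_of_lt hs.1) hs.2 θ).ne') using 1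
    ring

theorem integral_sqMod_rpow_mul_cos (ht : 0 < t) (hne : t ≠ a ^ 2) (r : ℝ) :
    ∫ θ in (0)..(2 * π), sqMod a t θ ^ r * cos θ =
      ∫ θ in (0)..(2 * π), r * sqMod a t θ ^ (r - 1) * (2 * a * √t * sin θ ^ 2) := by
  have hc : Continuous (sqMod a t) := by unfold sqMod; fun_prop
  have hr : ∀ r : ℝ, Continuous fun θ => sqMod a t θ ^ r := fun r =>
    hc.rpow_const fun θ => Or.inl (sqMod_pos ht.le hne θ).ne'
  have h1 : Continuous fun θ => sqMod a t θ ^ r * cos θ := (hr r).mul continuous_cos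
  have h2 : Continuous fun θ => r * sqMod a t θ ^ (r - 1) * (2 * a * √t * sin θ ^ 2) :=
    (continuous_const.mul (hr _)).mul (by fun_prop)
  have key : ∀ θ, HasDerivAt (fun θ => sqMod a t θ ^ r * sin θ)
      (sqMod a t θ ^ r * cos θ - r * sqMod a t θ ^ (r - 1) * (2 * a * √t * sin θ ^ 2)) θ := by
    intro θ
    have hX : HasDerivAt (sqMod a t) (-(2 * a * √t * sin θ)) θ := by
      unfold sqMod
      simpa using ((hasDerivAt_cos θ).const_mul (2 * a * √t)).const_add (a ^ 2 + t)
    refine ((hX.rpow_const (p := r) (Or.inl (sqMod_pos ht.le hne θ).ne')).mul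
      (hasDerivAt_sin θ)).congr_deriv ?_
    ring
  have := intervalIntegral.integral_eq_sub_of_hasDerivAt (a := 0) (b := 2 * π) (fun θ _ => key θ)
    ((h1.sub h2).intervalIntegrable _ _)
  rw [intervalIntegral.integral_sub (h1.intervalIntegrable _ _) (h2.intervalIntegrable _ _)] at this
  simp only [sin_two_pi, sin_zero, mul_zero, sub_zero] at this
  linarith

/-- If H and K are the power means of exponents q and q - 1, then t times the derivative of H has
derivative q² K. -/
theorem hasDerivAt_mul_deriv_integral (ht : 0 < t) (hne : t ≠ a ^ 2) :
    HasDerivAt (fun s => ∫ θ in (0)..(2 * π), q * sqMod a s θ ^ (q - 1) * (s + a * √s * cos θ))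
      (q ^ 2 * ∫ θ in (0)..(2 * π), sqMod a t θ ^ (q - 1)) t := by
  have hd := hasDerivAt_intervalIntegral_of_continuousOn (a := 0) (b := 2 * π)
    (F := fun s θ => q * sqMod a s θ ^ (q - 1) * (s + a * √s * cos θ))
    (F' := fun s θ => q * ((q - 1) * sqMod a s θ ^ (q - 1 - 1) * (1 + a * cos θ / √s)) *
      (s + a * √s * cos θ) + q * sqMod a s θ ^ (q - 1) * (1 + a * cos θ / √s / 2))
    (isOpen_Ioi_diff_singleton (x := 0) (y := a ^ 2)) ⟨ht, hne⟩
    ((continuousOn_const.mul (continuousOn_sqMod_rpow _)).mul (by fun_prop)) ?_ ?_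
  · convert hd using 1
    have hc : Continuous (sqMod a t) := by unfold sqMod; fun_prop
    have hr : ∀ r : ℝ, Continuous fun θ => sqMod a t θ ^ r := fun r =>
      hc.rpow_const fun θ => Or.inl (sqMod_pos ht.le hne θ).ne'
    have e : ∀ θ, q * ((q - 1) * sqMod a t θ ^ (q - 1 - 1) * (1 + a * cos θ / √t)) *
        (t + a * √t * cos θ) + q * sqMod a t θ ^ (q - 1) * (1 + a * cos θ / √t / 2) =
        q ^ 2 * sqMod a t θ ^ (q - 1) + (q * a / (2 * √t)) *
        (sqMod a t θ ^ (q - 1) * cos θ -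
          (q - 1) * sqMod a t θ ^ (q - 1 - 1) * (2 * a * √t * sin θ ^ 2)) := by
      intro θ
      have hX := sqMod_pos ht.le hne θ
      have hXe := sqMod_eq (a := a) ht.le θ
      have h1 : sqMod a t θ ^ (q - 1) = sqMod a t θ ^ (q - 1 - 1) * sqMod a t θ := by
        rw [← rpow_add_one hX.ne']; ring_nf
      rw [h1]
      generalize sqMod a t θ ^ (q - 1 - 1) = Z at *
      rw [hXe]
      have hs := sqrt_pos.2 ht
      have hst : t = √t ^ 2 := (sq_sqrt ht.le).symm
      generalize √t = τ at *
      subst hst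
      field_simp
      ring
    simp_rw [e]
    rw [intervalIntegral.integral_add, intervalIntegral.integral_const_mul,
      intervalIntegral.integral_const_mul, intervalIntegral.integral_sub,
      integral_sqMod_rpow_mul_cos ht hne]
    · simp
    · exact ((hr _).mul continuous_cos).intervalIntegrable _ _
    · exact ((continuous_const.mul (hr _)).mul (by fun_prop)).intervalIntegrable _ _
    · exact (continuous_const.mul (hr _)).intervalIntegrable _ _
    · exact (continuous_const.mul (((hr _).mul continuous_cos).sub
        ((continuous_const.mul (hr _)).mul (by fun_prop)))).intervalIntegrable _ _
  · have hdiv := (continuousOn_div_sqrt (a := a)).mono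
      (prod_mono (sdiff_subset (s := Ioi (0 : ℝ)) (t := {a ^ 2})) (Subset.refl (univ : Set ℝ)))
    exact ((continuousOn_const.mul ((continuousOn_const.mul (continuousOn_sqMod_rpow _)).mul
      (continuousOn_const.add hdiv))).mul (by fun_prop)).add
      ((continuousOn_const.mul (continuousOn_sqMod_rpow _)).mul
        (continuousOn_const.add (hdiv.div_const 2)))
  · intro s hs θ
    have h1 := ((hasDerivAt_sqMod (a := a) hs.1 θ).rpow_const (p := q - 1)
      (Or.inl (sqMod_pos (le_of_lt hs.1) hs.2 θ).ne')).const_mul q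
    have h2 := (hasDerivAt_id s).add
      (((hasDerivAt_sqrt (ne_of_gt hs.1)).const_mul a).mul_const (cos θ))
    refine (h1.mul h2).congr_deriv ?_
    simp only [id, Pi.add_apply]
    ring

/-- The mean of the Poisson kernel is `1`. -/
theorem integral_one_sub_div_sqMod (ha : 0 < a) (ht : 0 ≤ t) (hlt : t < a ^ 2) :
    ∫ θ in (0)..(2 * π), (1 - (a ^ 2 - t) / sqMod a t θ) = 0 := by
  have hτ : √t < a := by rw [sqrt_lt' ha]; exact hlt
  have h := DiffContOnCl.circleAverage_smul_div (f := fun _ : ℂ => (1 : ℂ)) (c := 0) (R := a)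
    (w := (-√t : ℝ)) diffContOnCl_const (by simpa [abs_of_pos ha, abs_of_nonneg (sqrt_nonneg t)])
  have hne : ∀ θ, circleMap 0 a θ + (√t : ℂ) ≠ 0 := by
    intro θ h0
    have : ‖circleMap 0 a θ‖ = √t := by
      rw [eq_neg_of_add_eq_zero_left h0]; simp
    simp [abs_of_pos ha] at this
    linarith
  have hc : Continuous (fun θ => circleMap 0 a θ / (circleMap 0 a θ + (√t : ℂ))) :=
    (continuous_circleMap _ _).div ((continuous_circleMap _ _).add continuous_const) hne
  have h' : ∫ θ in (0)..(2 * π), (circleMap 0 a θ / (circleMap 0 a θ + (√t : ℂ))) = 2 * π := by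
    rw [circleAverage_def] at h
    simp only [sub_zero, Complex.ofReal_neg, sub_neg_eq_add, smul_eq_mul, mul_one] at h
    have h2 : (2 * π : ℝ) ≠ 0 := by positivity
    rw [inv_smul_eq_iff₀ h2] at h
    simpa using h
  have h'' := congrArg Complex.re h'
  have h3 := Complex.reCLM.intervalIntegral_comp_comm (hc.intervalIntegrable 0 (2 * π)) (μ := volume)
  simp only [Complex.reCLM_apply] at h3
  rw [← h3] at h''
  have e : ∀ θ, 1 - (a ^ 2 - t) / sqMod a t θ =
      2 * (1 - (circleMap 0 a θ / (circleMap 0 a θ + (√t : ℂ))).re) := by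
    intro θ
    have hX := sqMod_pos ht hlt.ne θ
    have hre : (circleMap 0 a θ).re = a * cos θ := by simp [circleMap, Complex.exp_re]
    have him : (circleMap 0 a θ).im = a * sin θ := by simp [circleMap, Complex.exp_im]
    have hn : Complex.normSq (circleMap 0 a θ + (√t : ℂ)) = sqMod a t θ := by
      rw [Complex.normSq_apply, sqMod_eq ht]
      simp [hre, him]; ring
    rw [Complex.div_re, hn]
    simp only [Complex.add_re, Complex.add_im, hre, him, Complex.ofReal_re, Complex.ofReal_im]
    have hXe := sqMod_eq (a := a) ht θ
    field_simp
    have hst := sq_sqrt ht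
    have := sin_sq_add_cos_sq θ
    rw [hXe]
    linear_combination (-1) * hst + a ^ 2 * this
  simp_rw [e]
  rw [intervalIntegral.integral_const_mul, intervalIntegral.integral_sub (by simp)
    (Continuous.intervalIntegrable (by exact Complex.continuous_re.comp hc) _ _), h'']
  simp

theorem integral_deriv_sqMod_rpow_pos (ha : 0 ≤ a) (ht : 0 < t) (hne : t ≠ a ^ 2) {r : ℝ}
    (hr : 0 < r) :
    0 < ∫ θ in (0)..(2 * π), r * sqMod a t θ ^ (r - 1) * (1 + a * cos θ / √t) := by
  have hc : Continuous (sqMod a t) := by unfold sqMod; fun_prop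
  have hXpos := sqMod_pos ht.le hne
  have hpow : ∀ r : ℝ, Continuous fun θ => sqMod a t θ ^ r := fun r =>
    hc.rpow_const fun θ => Or.inl (hXpos θ).ne'
  have hτ := sqrt_pos.2 ht
  have e : ∀ θ, r * sqMod a t θ ^ (r - 1) * (1 + a * cos θ / √t) =
      (r / (2 * t)) * (sqMod a t θ ^ r * (1 - (a ^ 2 - t) / sqMod a t θ)) := by
    intro θ
    have hX := hXpos θ
    have h1 : sqMod a t θ ^ r = sqMod a t θ ^ (r - 1) * sqMod a t θ := by
      rw [← rpow_add_one hX.ne']; ring_nf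
    have h2 : sqMod a t θ * (1 - (a ^ 2 - t) / sqMod a t θ) = 2 * t * (1 + a * cos θ / √t) := by
      rw [mul_sub, mul_div_cancel₀ _ hX.ne']
      unfold sqMod
      have hst := sq_sqrt ht.le
      field_simp
      linear_combination (-2 * a * cos θ) * (-hst)
    rw [h1, mul_assoc (sqMod a t θ ^ (r - 1)), h2]
    field_simp
  simp_rw [e]
  rw [intervalIntegral.integral_const_mul]
  refine mul_pos (by positivity) ?_
  have hcont : Continuous fun θ => sqMod a t θ ^ r * (1 - (a ^ 2 - t) / sqMod a t θ) :=
    (hpow r).mul (continuous_const.sub (continuous_const.div hc fun θ => (hXpos θ).ne'))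
  rcases hne.lt_or_gt with hlt | hgt
  · have ha' : 0 < a := by
      refine ha.lt_of_ne' ?_
      rintro rfl
      norm_num at hlt; linarith
    have hB : 0 < a ^ 2 - t := sub_pos.2 hlt
    have h0 := congrArg ((a ^ 2 - t) ^ r * ·) (integral_one_sub_div_sqMod ha' ht.le hlt)
    simp only [mul_zero] at h0
    rw [← intervalIntegral.integral_const_mul] at h0
    refine h0.symm.trans_lt ?_
    refine intervalIntegral.integral_lt_integral_of_continuousOn_of_le_of_exists_lt (by positivity)
      (Continuous.continuousOn ?_) hcont.continuousOn ?_ ⟨0, by simp; positivity, ?_⟩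
    · exact continuous_const.mul
        (continuous_const.sub (continuous_const.div hc fun θ => (hXpos θ).ne'))
    · intro θ _
      rcases le_total (a ^ 2 - t) (sqMod a t θ) with h | h
      · exact mul_le_mul_of_nonneg_right (rpow_le_rpow hB.le h hr.le)
          (sub_nonneg.2 ((div_le_one (hXpos θ)).2 h))
      · exact mul_le_mul_of_nonpos_right (rpow_le_rpow (hXpos θ).le h hr.le)
          (sub_nonpos.2 ((one_le_div (hXpos θ)).2 h))
    · have h : a ^ 2 - t < sqMod a t 0 := by
        unfold sqMod; rw [cos_zero]
        have : 0 < 2 * a * √t * 1 := by positivity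
        linarith
      exact mul_lt_mul_of_pos_right (rpow_lt_rpow hB.le h hr)
          (sub_pos.2 ((div_lt_one (hXpos 0)).2 h))
  · refine intervalIntegral.intervalIntegral_pos_of_pos (hcont.intervalIntegrable _ _)
      (fun θ => mul_pos (rpow_pos_of_pos (hXpos θ) r) ?_) (by positivity)
    have : (a ^ 2 - t) / sqMod a t θ < 0 := div_neg_of_neg_of_pos (by linarith) (hXpos θ)
    linarith

theorem continuous_integral_sqMod_rpow (hq : 0 ≤ q) :
    Continuous fun s => ∫ θ in (0)..(2 * π), sqMod a s θ ^ q :=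
  intervalIntegral.continuous_parametric_intervalIntegral_of_continuous'
    (f := fun s θ => sqMod a s θ ^ q)
    (continuous_sqMod.rpow_const fun _ => Or.inr hq) _ _

theorem strictMonoOn_Ici_of_hasDerivAt_pos {f f' : ℝ → ℝ} {x y : ℝ}
    (hf : ContinuousOn f (Ici x)) (hd : ∀ t, x < t → t ≠ y → HasDerivAt f (f' t) t)
    (hpos : ∀ t, x < t → t ≠ y → 0 < f' t) : StrictMonoOn f (Ici x) := by
  have aux : ∀ D : Set ℝ, Convex ℝ D → D ⊆ Ici x → y ∉ interior D → StrictMonoOn f D := by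
    intro D hD hDx hy
    refine strictMonoOn_of_deriv_pos hD (hf.mono hDx) fun t ht => ?_
    have h1 : x < t := by simpa using interior_mono hDx ht
    have h2 : t ≠ y := fun h => hy (h ▸ ht)
    rw [(hd t h1 h2).deriv]
    exact hpos t h1 h2
  rcases le_or_gt x y with hxy | hxy
  · rw [← Icc_union_Ici_eq_Ici hxy]
    exact (aux (Icc x y) (convex_Icc x y) Icc_subset_Ici_self (by simp)).union
      (aux (Ici y) (convex_Ici y) (Ici_subset_Ici.2 hxy) (by simp))
      (isGreatest_Icc hxy) isLeast_Ici
  · exact aux _ (convex_Ici x) Subset.rfl (by simp [hxy.le])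

/-- The mean of `|w + √t e^{iθ}|^{2q}` over the circle is strictly convex in `t`. -/
theorem strictConvexOn_integral_sqMod_rpow (ha : 0 ≤ a) (hq : 1 < q) :
    StrictConvexOn ℝ (Ici 0) fun t => ∫ θ in (0)..(2 * π), sqMod a t θ ^ q := by
  set J : ℝ → ℝ := fun s => ∫ θ in (0)..(2 * π), q * sqMod a s θ ^ (q - 1) * (s + a * √s * cos θ)
    with hJ
  set K : ℝ → ℝ := fun s => ∫ θ in (0)..(2 * π), sqMod a s θ ^ (q - 1) with hK
  have hJc : Continuous J :=
    intervalIntegral.continuous_parametric_intervalIntegral_of_continuous'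
      (f := fun s θ => q * sqMod a s θ ^ (q - 1) * (s + a * √s * cos θ))
      ((continuous_const.mul (continuous_sqMod.rpow_const fun _ => Or.inr (by linarith))).mul
        (by fun_prop)) _ _
  have hKc : Continuous K := continuous_integral_sqMod_rpow (by linarith)
  have hJd : ∀ t, 0 < t → t ≠ a ^ 2 → HasDerivAt J (q ^ 2 * K t) t := fun t ht hne =>
    hasDerivAt_mul_deriv_integral ht hne
  have hHd : ∀ t, 0 < t →
      HasDerivAt (fun t => ∫ θ in (0)..(2 * π), sqMod a t θ ^ q) (J t / t) t := by
    intro t ht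
    refine (hasDerivAt_integral_sqMod_rpow (a := a) hq ht).congr_deriv ?_
    symm
    rw [hJ, ← intervalIntegral.integral_div]
    refine intervalIntegral.integral_congr fun θ _ => ?_
    have hτ := sqrt_pos.2 ht
    have hst := sq_sqrt ht.le
    field_simp
    linear_combination (sqMod a t θ ^ (q - 1) * a * cos θ) * hst
  have hD : StrictMonoOn (fun t => q ^ 2 * (t * K t) - J t) (Ici 0) := by
    refine strictMonoOn_Ici_of_hasDerivAt_pos (y := a ^ 2)
      (f' := fun t => q ^ 2 * (t * ∫ θ in (0)..(2 * π), (q - 1) * sqMod a t θ ^ (q - 1 - 1) *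
        (1 + a * cos θ / √t))) (by fun_prop) (fun t ht hne => ?_) fun t ht hne => ?_
    · refine ((((hasDerivAt_id t).mul
        (hasDerivAt_integral_sqMod_rpow_of_ne (q := q - 1) ht hne)).const_mul (q ^ 2)).sub
        (hJd t ht hne)).congr_deriv ?_
      simp only [id, hK]
      ring
    · have := integral_deriv_sqMod_rpow_pos ha ht hne (r := q - 1) (by linarith)
      positivity
  have hDpos : ∀ t, 0 < t → 0 < q ^ 2 * (t * K t) - J t := by
    intro t ht
    have h := hD self_mem_Ici ht.le ht
    have hJ0 : J 0 = 0 := by simp [hJ]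
    simpa [hJ0] using h
  refine StrictMonoOn.strictConvexOn_of_deriv (convex_Ici 0)
    (continuous_integral_sqMod_rpow (by linarith)).continuousOn ?_
  rw [interior_Ici]
  have hmono : ∀ x, 0 < x → StrictMonoOn (fun t => J t / t) (Ici x) := by
    intro x hx
    refine strictMonoOn_Ici_of_hasDerivAt_pos (y := a ^ 2)
      (f' := fun t => (q ^ 2 * (t * K t) - J t) / t ^ 2)
      (hJc.continuousOn.div continuousOn_id fun t ht => (hx.trans_le ht).ne')
      (fun t ht hne => ?_) fun t ht hne => ?_
    · refine ((hJd t (hx.trans ht) hne).div (hasDerivAt_id t) (hx.trans ht).ne').congr_deriv ?_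
      simp only [id]
      ring
    · have := hDpos t (hx.trans ht)
      have := hx.trans ht
      positivity
  intro x hx y hy hxy
  rw [(hHd x hx).deriv, (hHd y hy).deriv]
  exact hmono x hx self_mem_Ici hxy.le hxy

end sqMod

theorem StrictConvexOn.integral_comp_add_mul_cos_lt {Φ : ℝ → ℝ} (hΦ : StrictConvexOn ℝ (Ici 0) Φ)
    (hc : Continuous Φ) {s k l : ℝ} (hk : 0 ≤ k) (hkl : k < l) (hls : l ≤ s) :
    ∫ φ in (0)..(2 * π), Φ (s + k * cos φ) < ∫ φ in (0)..(2 * π), Φ (s + l * cos φ) := by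
  have hl : 0 < l := hk.trans_lt hkl
  have hsymm : ∫ φ in (0)..(2 * π), Φ (s - l * cos φ) = ∫ φ in (0)..(2 * π), Φ (s + l * cos φ) := by
    have hper : Function.Periodic (fun φ => Φ (s + l * cos φ)) (2 * π) := fun φ => by simp
    have h := intervalIntegral.integral_comp_add_right (a := 0) (b := 2 * π)
      (fun φ => Φ (s + l * cos φ)) π
    simp only [cos_add_pi, mul_neg, ← sub_eq_add_neg] at h
    rw [h, zero_add, add_comm (2 * π), hper.intervalIntegral_add_eq π 0, zero_add]
  have hmem : ∀ x ∈ Icc (-1 : ℝ) 1, s + l * x ∈ Ici (0 : ℝ) := fun x hx => by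
    have := mul_le_mul_of_nonneg_left hx.1 hl.le
    simp only [mem_Ici]; linarith
  have hcos : ∀ φ, cos φ ∈ Icc (-1 : ℝ) 1 := fun φ => ⟨neg_one_le_cos φ, cos_le_one φ⟩
  set m : ℝ := (1 + k / l) / 2 with hm
  have hkl' : k / l < 1 := (div_lt_one hl).2 hkl
  have hkl0 : 0 ≤ k / l := by positivity
  have hcomb : ∀ x, s + k * x = m • (s + l * x) + (1 - m) • (s - l * x) := fun x => by
    simp only [smul_eq_mul, hm]; field_simp; ring
  have hneg : ∀ φ, s - l * cos φ ∈ Ici (0 : ℝ) := fun φ => by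
    have := hmem (-cos φ) ⟨by linarith [cos_le_one φ], by linarith [neg_one_le_cos φ]⟩
    rwa [mul_neg, ← sub_eq_add_neg] at this
  have hlt : ∫ φ in (0)..(2 * π), Φ (s + k * cos φ) <
      ∫ φ in (0)..(2 * π), (m * Φ (s + l * cos φ) + (1 - m) * Φ (s - l * cos φ)) := by
    refine intervalIntegral.integral_lt_integral_of_continuousOn_of_le_of_exists_lt (by positivity)
      (by fun_prop) (by fun_prop) (fun φ _ => ?_) ⟨0, by simp; positivity, ?_⟩
    · rw [hcomb]
      exact hΦ.convexOn.2 (hmem _ (hcos φ)) (hneg φ) (by linarith) (by linarith) (by ring)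
    · rw [hcomb]
      refine hΦ.2 (hmem _ (hcos 0)) (hneg 0) ?_ (by linarith) (by linarith) (by ring)
      rw [cos_zero]; intro h; linarith
  refine hlt.trans_eq ?_
  rw [intervalIntegral.integral_add (Continuous.intervalIntegrable (by fun_prop) _ _)
    (Continuous.intervalIntegrable (by fun_prop) _ _), intervalIntegral.integral_const_mul,
    intervalIntegral.integral_const_mul, hsymm]
  ring

/-- The operator averaging a continuous function over circles of radius `r`. -/
noncomputable def circMean (r : ℝ) (f : C(ℂ, ℝ)) : C(ℂ, ℝ) where
  toFun w := circleAverage f w r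
  continuous_toFun := by
    have h : Continuous (Function.uncurry fun (w : ℂ) (θ : ℝ) => f (circleMap w r θ)) := by
      unfold circleMap Function.uncurry
      fun_prop
    exact (intervalIntegral.continuous_parametric_intervalIntegral_of_continuous' (μ := volume)
      h 0 (2 * π)).const_smul ((2 * π)⁻¹ : ℝ)

theorem circMean_apply (r : ℝ) (f : C(ℂ, ℝ)) (w : ℂ) :
    circMean r f w = (2 * π)⁻¹ * ∫ θ in (0)..(2 * π), f (circleMap w r θ) := rfl

theorem circMean_zero : circMean 0 = id := by
  ext f w
  exact circleAverage_zero

theorem circMean_circMean_apply (a b : ℝ) (f : C(ℂ, ℝ)) (w : ℂ) :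
    circMean a (circMean b f) w = (2 * π)⁻¹ * ((2 * π)⁻¹ *
      ∫ θ in (0)..(2 * π), ∫ φ in (0)..(2 * π), f (circleMap (circleMap w a θ) b φ)) := by
  simp_rw [circMean_apply, intervalIntegral.integral_const_mul]

theorem intervalIntegral_swap_of_continuous {F : ℝ → ℝ → ℝ} (hF : Continuous (Function.uncurry F))
    (a b c d : ℝ) :
    ∫ x in a..b, ∫ y in c..d, F x y = ∫ y in c..d, ∫ x in a..b, F x y :=
  intervalIntegral_intervalIntegral_swap
    ((hF.continuousOn.integrableOn_compact (isCompact_uIcc.prod isCompact_uIcc)).mono_set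
      (prod_mono uIoc_subset_uIcc uIoc_subset_uIcc))

theorem circMean_commute (a b : ℝ) : Function.Commute (circMean a) (circMean b) := by
  intro f
  ext w
  rw [circMean_circMean_apply, circMean_circMean_apply, intervalIntegral_swap_of_continuous]
  · congr 5 with φ
    congr 1 with θ
    congr 1
    simp only [circleMap]; ring
  · unfold circleMap Function.uncurry
    fun_prop

theorem circMean_lt {f g : C(ℂ, ℝ)} (h : ∀ w, f w < g w) (r : ℝ) (w : ℂ) :
    circMean r f w < circMean r g w := by
  rw [circMean_apply, circMean_apply]
  refine mul_lt_mul_of_pos_left ?_ (by positivity)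
  have hc : ∀ f : C(ℂ, ℝ), ContinuousOn (fun θ => f (circleMap w r θ)) (Icc 0 (2 * π)) := fun f =>
    (f.continuous.comp (continuous_circleMap w r)).continuousOn
  exact intervalIntegral.integral_lt_integral_of_continuousOn_of_le_of_exists_lt (by positivity)
    (hc f) (hc g) (fun θ _ => (h _).le) ⟨0, by simp; positivity, h _⟩

theorem circMean_iterate_lt {f g : C(ℂ, ℝ)} (h : ∀ w, f w < g w) (r : ℝ) (n : ℕ) (w : ℂ) :
    (circMean r)^[n] f w < (circMean r)^[n] g w := by
  induction n generalizing w with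
  | zero => exact h w
  | succ n ih => simpa only [Function.iterate_succ_apply'] using circMean_lt ih r w

/-- The function `z ↦ ‖z‖ ^ p` for `p ≥ 0`. -/
noncomputable def normPow (p : ℝ) (hp : 0 ≤ p) : C(ℂ, ℝ) where
  toFun z := ‖z‖ ^ p
  continuous_toFun := continuous_norm.rpow_const fun _ => Or.inr hp

theorem integral_normPow_rotate {p : ℝ} (hp : 0 ≤ p) (w ζ : ℂ) :
    ∫ θ in (0)..(2 * π), normPow p hp (w + ζ * Complex.exp (θ * Complex.I)) =
      ∫ θ in (0)..(2 * π), sqMod ‖w‖ (‖ζ‖ ^ 2) θ ^ (p / 2) := by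
  set F : ℝ → ℝ := fun θ => normPow p hp (w + ζ * Complex.exp (θ * Complex.I)) with hF
  have hper : Function.Periodic F (2 * π) := fun θ => by
    simp only [hF]
    congr 3
    push_cast
    rw [add_mul, Complex.exp_add, Complex.exp_two_pi_mul_I, mul_one]
  have h := intervalIntegral.integral_comp_add_right (a := 0) (b := 2 * π) F (w.arg - ζ.arg)
  rw [zero_add, add_comm (2 * π), hper.intervalIntegral_add_eq _ 0, zero_add] at h
  rw [← h]
  refine intervalIntegral.integral_congr fun θ _ => ?_
  have e : w + ζ * Complex.exp ((θ + (w.arg - ζ.arg) : ℝ) * Complex.I) =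
      Complex.exp (w.arg * Complex.I) * (‖w‖ + ‖ζ‖ * Complex.exp (θ * Complex.I)) := by
    have hw := Complex.norm_mul_exp_arg_mul_I w
    have hζ := Complex.norm_mul_exp_arg_mul_I ζ
    have : Complex.exp ((θ + (w.arg - ζ.arg) : ℝ) * Complex.I) * Complex.exp (ζ.arg * Complex.I) =
        Complex.exp (w.arg * Complex.I) * Complex.exp (θ * Complex.I) := by
      rw [← Complex.exp_add, ← Complex.exp_add]; congr 1; push_cast; ring
    linear_combination (-1) * hw - Complex.exp ((θ + (w.arg - ζ.arg) : ℝ) * Complex.I) * hζ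
      + ‖ζ‖ * this
  have hn : ‖w + ζ * Complex.exp ((θ + (w.arg - ζ.arg) : ℝ) * Complex.I)‖ ^ 2 =
      sqMod ‖w‖ (‖ζ‖ ^ 2) θ := by
    rw [e, norm_mul, Complex.norm_exp_ofReal_mul_I, one_mul, ← Complex.normSq_eq_norm_sq,
      Complex.normSq_apply, sqMod, sqrt_sq (norm_nonneg _)]
    simp [Complex.exp_ofReal_mul_I_re, Complex.exp_ofReal_mul_I_im]
    linear_combination ‖ζ‖ ^ 2 * sin_sq_add_cos_sq θ
  simp only [hF]
  rw [← hn, ← rpow_natCast, ← rpow_mul (norm_nonneg _)]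
  simp only [normPow, ContinuousMap.coe_mk]
  congr 1
  push_cast; ring

theorem circMean_circMean_normPow {p : ℝ} (hp : 0 ≤ p) (a b : ℝ) (w : ℂ) :
    circMean a (circMean b (normPow p hp)) w = (2 * π)⁻¹ * ((2 * π)⁻¹ *
      ∫ φ in (0)..(2 * π), ∫ θ in (0)..(2 * π),
        sqMod ‖w‖ (a ^ 2 + b ^ 2 + 2 * (a * b) * cos φ) θ ^ (p / 2)) := by
  rw [circMean_circMean_apply]
  congr 2
  have h1 : ∀ θ : ℝ, ∫ φ in (0)..(2 * π), normPow p hp (circleMap (circleMap w a θ) b φ) =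
      ∫ φ in (0)..(2 * π), normPow p hp (circleMap (circleMap w a θ) b (φ + θ)) := by
    intro θ
    have h := circleAverage_eq_integral_add (f := normPow p hp) (c := circleMap w a θ) (R := b) θ
    rw [circleAverage_def] at h
    exact (smul_right_injective ℝ (by positivity : (2 * π)⁻¹ ≠ 0)) h
  simp_rw [h1]
  rw [intervalIntegral_swap_of_continuous]
  · refine intervalIntegral.integral_congr fun φ _ => ?_
    have h2 := integral_normPow_rotate hp w (a + b * Complex.exp (φ * Complex.I))
    have h3 : ‖(a + b * Complex.exp (φ * Complex.I) : ℂ)‖ ^ 2 =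
        a ^ 2 + b ^ 2 + 2 * (a * b) * cos φ := by
      rw [← Complex.normSq_eq_norm_sq, Complex.normSq_apply]
      simp [Complex.exp_ofReal_mul_I_re, Complex.exp_ofReal_mul_I_im]
      linear_combination b ^ 2 * sin_sq_add_cos_sq φ
    rw [h3] at h2
    rw [← h2]
    refine intervalIntegral.integral_congr fun θ _ => ?_
    simp only [circleMap]
    congr 1
    push_cast
    rw [add_mul (φ : ℂ), Complex.exp_add]
    ring
  · unfold circleMap Function.uncurry
    fun_prop

/-- Making two radii with fixed sum of squares more balanced increases the `p`-th moment. -/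
theorem circMean_circMean_normPow_lt {p : ℝ} (hp : 2 < p) {a b a' b' : ℝ} (hab : 0 ≤ a * b)
    (hlt : a * b < a' * b') (hsq : a ^ 2 + b ^ 2 = a' ^ 2 + b' ^ 2) (w : ℂ) :
    circMean a (circMean b (normPow p (by linarith))) w <
      circMean a' (circMean b' (normPow p (by linarith))) w := by
  rw [circMean_circMean_normPow, circMean_circMean_normPow, hsq]
  refine mul_lt_mul_of_pos_left (mul_lt_mul_of_pos_left ?_ (by positivity)) (by positivity)
  exact (strictConvexOn_integral_sqMod_rpow (norm_nonneg w)
    (by linarith : 1 < p / 2)).integral_comp_add_mul_cos_lt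
    (continuous_integral_sqMod_rpow (by linarith)) (by linarith) (by linarith)
    (by nlinarith [sq_nonneg (a' - b')])

theorem circMean_iterate_normPow_lt {p : ℝ} (hp : 2 < p) {d : ℕ} (hd : 1 ≤ d) :
    (circMean (1 / √d))^[d] (normPow p (by linarith)) 0 <
      (circMean (1 / √(d + 1)))^[d + 1] (normPow p (by linarith)) 0 := by
  have hd0 : (0 : ℝ) < d := by exact_mod_cast hd
  set r : ℝ := 1 / √d with hr
  set r' : ℝ := 1 / √(d + 1) with hr'
  have hr2 : r ^ 2 = 1 / d := by rw [hr, div_pow, sq_sqrt hd0.le, one_pow]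
  have hr2' : r' ^ 2 = 1 / (d + 1) := by rw [hr', div_pow, sq_sqrt (by positivity), one_pow]
  have hr0 : 0 < r := by positivity
  have hr0' : 0 < r' := by positivity
  set x : ℕ → ℝ := fun j => √(j / (d * (d + 1))) with hx
  have hx2 : ∀ j, x j ^ 2 = j / (d * (d + 1)) := fun j => sq_sqrt (by positivity)
  set N := normPow p (by linarith : 0 ≤ p) with hN
  set P : ℕ → ℝ := fun j => (circMean r')^[j] ((circMean r)^[d - j] (circMean (x j) N)) 0 with hP
  have hstep : ∀ j < d, P j < P (j + 1) := by
    intro j hj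
    obtain ⟨n, hn⟩ : ∃ n, d - j = n + 1 := ⟨d - j - 1, by omega⟩
    have hn' : d - (j + 1) = n := by omega
    simp only [hP]
    rw [hn, hn', Function.iterate_succ_apply (circMean r), Function.iterate_succ_apply (circMean r'),
      ((circMean_commute r' r).iterate_right n) (circMean (x (j + 1)) N)]
    refine circMean_iterate_lt (circMean_iterate_lt (fun w => ?_) r n) r' j 0
    refine circMean_circMean_normPow_lt hp (by positivity) ?_ ?_ w
    · refine lt_of_pow_lt_pow_left₀ 2 (by positivity) ?_
      rw [mul_pow, mul_pow, hx2, hx2, hr2, hr2', div_mul_div_comm, div_mul_div_comm,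
        div_lt_div_iff₀ (by positivity) (by positivity)]
      have hj' : (j : ℝ) < d := by exact_mod_cast hj
      have : 0 < (d : ℝ) * (d + 1) * (d - j) := by
        have := sub_pos.2 hj'
        positivity
      push_cast
      nlinarith
    · rw [hx2, hx2, hr2, hr2']
      push_cast
      field_simp
      ring
  have hmono : ∀ j ≤ d, 1 ≤ j → P 0 < P j := by
    intro j hj h1
    induction j, h1 using Nat.le_induction with
    | base => exact hstep 0 hd
    | succ j h1 ih => exact (ih (by omega)).trans (hstep j (by omega))
  have h := hmono d le_rfl hd
  have hx0 : x 0 = 0 := by simp [hx]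
  have hxd : x d = r' := by
    simp only [hx, hr']
    rw [div_mul_cancel_left₀ hd0.ne', sqrt_inv, one_div]
  simp only [hP, hx0, hxd, circMean_zero, id, Function.iterate_zero, Nat.sub_zero, Nat.sub_self] at h
  rwa [← Function.iterate_succ_apply] at h

theorem integral_unitCube_eq_circMean_iterate (f : C(ℂ, ℝ)) (r : ℝ) (d : ℕ) (w : ℂ) :
    ∫ θ in univ.pi fun _ : Fin d => Ioc (0 : ℝ) 1,
      f (w + ∑ j, r * Complex.exp (2 * π * Complex.I * θ j)) = (circMean r)^[d] f w := by
  induction d generalizing w with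
  | zero => simp [volume_pi, Measure.real, Measure.pi_pi]
  | succ d ih =>
    have hmp := measurePreserving_piFinSuccAbove
      (fun _ : Fin (d + 1) => (volume : Measure ℝ).restrict (Ioc 0 1)) 0
    have hint : Integrable (fun θ : Fin (d + 1) → ℝ =>
        f (w + ∑ j, r * Complex.exp (2 * π * Complex.I * θ j)))
        (Measure.pi fun _ => (volume : Measure ℝ).restrict (Ioc 0 1)) := by
      rw [← Measure.restrict_pi_pi, ← volume_pi]
      refine (Continuous.continuousOn (by fun_prop)).integrableOn_compact
        (isCompact_univ_pi fun _ => isCompact_Icc (a := (0 : ℝ)) (b := 1)) |>.mono_set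
        (pi_mono fun _ _ => Ioc_subset_Icc_self)
    rw [volume_pi, Measure.restrict_pi_pi, ← hmp.symm.integral_comp', integral_prod]
    · rw [Function.iterate_succ_apply', circMean_apply]
      have h := intervalIntegral.mul_integral_comp_mul_left (a := 0) (b := 1)
        (f := fun θ => (circMean r)^[d] f (circleMap w r θ)) (2 * π)
      rw [mul_zero, mul_one] at h
      rw [← h, ← mul_assoc, inv_mul_cancel₀ (by positivity), one_mul,
        intervalIntegral.integral_of_le zero_le_one]
      refine integral_congr_ae (ae_of_all _ fun t => ?_)
      simp only
      rw [← ih, volume_pi, Measure.restrict_pi_pi]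
      refine integral_congr_ae (ae_of_all _ fun θ => ?_)
      simp only [MeasurableEquiv.piFinSuccAbove_symm_apply, Fin.insertNthEquiv, Equiv.coe_fn_mk,
        Fin.insertNth_zero', Fin.sum_univ_succ, Fin.cons_zero, Fin.cons_succ, circleMap]
      congr 1
      push_cast
      rw [mul_right_comm _ Complex.I]
      ring
    · exact (hmp.symm.integrable_comp_emb (MeasurableEquiv.measurableEmbedding _)).2 hint

theorem normSumMoment_eq {p : ℝ} (hp : 0 ≤ p) {d : ℕ} (hd : 1 ≤ d) :
    normSumMoment p d = (circMean (1 / √d))^[d] (normPow p hp) 0 := by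
  have hd0 : (0 : ℝ) < d := by exact_mod_cast hd
  rw [← integral_unitCube_eq_circMean_iterate, normSumMoment, ← integral_div]
  refine integral_congr_ae (ae_of_all _ fun θ => ?_)
  simp only [normPow, ContinuousMap.coe_mk, zero_add]
  rw [← Finset.mul_sum, norm_mul, Complex.norm_real, norm_of_nonneg (by positivity),
    mul_rpow (by positivity) (norm_nonneg _), div_rpow zero_le_one (sqrt_nonneg _), one_rpow,
    sqrt_eq_rpow, ← rpow_mul hd0.le]
  ring_nf

theorem stmt_14 (p : ℝ) (hp : 2 < p) :
    ∀ d : ℕ, 1 ≤ d → normSumMoment p d < normSumMoment p (d + 1) := by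
  intro d hd
  have hp0 : 0 ≤ p := by linarith
  rw [normSumMoment_eq hp0 hd, normSumMoment_eq hp0 (Nat.le_add_left 1 d)]
  push_cast
  exact circMean_iterate_normPow_lt hp hd
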